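/- For a general choice of k skew-symmetric 2k×2k matrices H_1, …, H_k whose entries are linear forms in four variables over ℂ, the ideal generated by the submaximal Pfaffians of all the H_i coincides with the polynomial ring R = ℂ[x1,x2,x3,x4] in every degree d ≥ k. -/

import Mathlib

open MvPolynomial

/-- The Pfaffian of a `2n × 2n` matrix of multivariate polynomials over `ℂ`,
given by the standard averaged signed sum over permutations. -/
noncomputable def pfaff {σ : Type*} {n : ℕ}
    (M : Matrix (Fin (2*n)) (Fin (2*n)) (MvPolynomial σ ℂ)) : MvPolynomial σ ℂ :=
  (((2^n * n.factorial : ℕ) : ℂ)⁻¹) •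
    ∑ p : Equiv.Perm (Fin (2*n)),
      (Equiv.Perm.sign p : ℤ) •
        ∏ i : Fin n, M (p ⟨2*i.1, by have := i.2; omega⟩) (p ⟨2*i.1+1, by have := i.2; omega⟩)

/-- A square matrix of polynomials is skew-symmetric. -/
def IsSkew {m : Type*} {R : Type*} [Ring R] (M : Matrix m m R) : Prop :=
  ∀ i j, M j i = - M i j

/-- A square integer matrix is homogeneous. -/
def HomogMat {m : Type*} (A : Matrix m m ℕ) : Prop :=
  ∀ i j l r, A i j + A l r = A i r + A l j

/-- A matrix of polynomials has degree matrix `A`. -/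
def DegMat {σ m : Type*} (M : Matrix m m (MvPolynomial σ ℂ)) (A : Matrix m m ℕ) : Prop :=
  ∀ i j, (M i j).IsHomogeneous (A i j)

/-- The set of submaximal Pfaffians of a skew-symmetric matrix of even size `2k`:
Pfaffians of the submatrices obtained by erasing two rows and the two columns
with the same indexes. -/
def submaxPfEven {σ : Type*} {k : ℕ}
    (M : Matrix (Fin (2*k)) (Fin (2*k)) (MvPolynomial σ ℂ)) : Set (MvPolynomial σ ℂ) :=
  { q | ∃ e : Fin (2*(k-1)) ↪o Fin (2*k), q = pfaff (M.submatrix e e) }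

/-- The set of submaximal Pfaffians of a skew-symmetric matrix of odd size `2k-1`:
Pfaffians of the submatrices obtained by erasing one row and the column
with the same index. -/
def submaxPfOdd {σ : Type*} {k : ℕ}
    (M : Matrix (Fin (2*k-1)) (Fin (2*k-1)) (MvPolynomial σ ℂ)) : Set (MvPolynomial σ ℂ) :=
  { q | ∃ e : Fin (2*(k-1)) ↪o Fin (2*k-1), q = pfaff (M.submatrix e e) }

/-- The sum over all permutations whose average is the Pfaffian. -/
noncomputable def pfaffSum {R : Type*} [CommRing R] {n : ℕ}
    (M : Matrix (Fin (2*n)) (Fin (2*n)) R) : R :=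
  ∑ p : Equiv.Perm (Fin (2*n)),
    (Equiv.Perm.sign p : ℤ) •
      ∏ i : Fin n, M (p ⟨2*i.1, by have := i.2; omega⟩) (p ⟨2*i.1+1, by have := i.2; omega⟩)

theorem pfaff_eq_smul_pfaffSum {σ : Type*} {n : ℕ}
    (M : Matrix (Fin (2*n)) (Fin (2*n)) (MvPolynomial σ ℂ)) :
    pfaff M = (((2^n * n.factorial : ℕ) : ℂ)⁻¹) • pfaffSum M := rfl

theorem pfaffSum_eq_smul_pfaff {σ : Type*} {n : ℕ}
    (M : Matrix (Fin (2*n)) (Fin (2*n)) (MvPolynomial σ ℂ)) :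
    pfaffSum M = ((2^n * n.factorial : ℕ) : ℂ) • pfaff M := by
  rw [pfaff_eq_smul_pfaffSum, smul_inv_smul₀]
  exact Nat.cast_ne_zero.mpr (by positivity)

theorem map_pfaffSum {R S : Type*} [CommRing R] [CommRing S] (f : R →+* S) {n : ℕ}
    (M : Matrix (Fin (2*n)) (Fin (2*n)) R) : f (pfaffSum M) = pfaffSum (M.map f) := by
  simp [pfaffSum, map_sum, map_prod]

theorem isHomogeneous_pfaffSum {σ R : Type*} [CommRing R] {n : ℕ}
    {M : Matrix (Fin (2*n)) (Fin (2*n)) (MvPolynomial σ R)}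
    (hM : ∀ i j, (M i j).IsHomogeneous 1) : (pfaffSum M).IsHomogeneous n := by
  refine IsHomogeneous.sum _ _ _ fun p _ => ?_
  rw [← mem_homogeneousSubmodule]
  refine zsmul_mem ?_ _
  rw [mem_homogeneousSubmodule]
  simpa using IsHomogeneous.prod Finset.univ
    (fun i : Fin n => M (p ⟨2*i.1, by have := i.2; omega⟩) (p ⟨2*i.1+1, by have := i.2; omega⟩))
    (fun _ => 1) fun i _ => hM _ _

/-- The index set `Fin (2*n)` as `n` consecutive pairs. -/
def pairEquiv (n : ℕ) : Fin n × Fin 2 ≃ Fin (2*n) :=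
  finProdFinEquiv.trans (finCongr (mul_comm n 2))

theorem pairEquiv_zero {n : ℕ} (i : Fin n) :
    pairEquiv n (i, 0) = ⟨2*i.1, by have := i.2; omega⟩ := by
  ext; simp [pairEquiv]

theorem pairEquiv_one {n : ℕ} (i : Fin n) :
    pairEquiv n (i, 1) = ⟨2*i.1+1, by have := i.2; omega⟩ := by
  ext; simp [pairEquiv]; omega

theorem exists_pair_of_adjacent {n : ℕ} (p : Equiv.Perm (Fin (2*n)))
    (hp : ∀ i : Fin n, (p (pairEquiv n (i, 0))).1 = (p (pairEquiv n (i, 1))).1 + 1 ∨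
      (p (pairEquiv n (i, 1))).1 = (p (pairEquiv n (i, 0))).1 + 1) (j : Fin n) :
    ∃ i : Fin n, ∃ f : Equiv.Perm (Fin 2), ∀ b, p (pairEquiv n (i, b)) = pairEquiv n (j, f b) := by
  suffices h : ∀ m : ℕ, ∀ hm : m < n, ∃ i : Fin n,
      ((p (pairEquiv n (i, 0))).1 = 2*m ∧ (p (pairEquiv n (i, 1))).1 = 2*m+1) ∨
      ((p (pairEquiv n (i, 0))).1 = 2*m+1 ∧ (p (pairEquiv n (i, 1))).1 = 2*m) by
    obtain ⟨i, h | h⟩ := h j.1 j.2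
    · refine ⟨i, 1, fun b => ?_⟩
      fin_cases b
      · simpa [Fin.ext_iff, pairEquiv_zero] using h.1
      · simpa [Fin.ext_iff, pairEquiv_one] using h.2
    · refine ⟨i, Equiv.swap 0 1, fun b => ?_⟩
      fin_cases b
      · simpa [Fin.ext_iff, pairEquiv_one] using h.1
      · simpa [Fin.ext_iff, pairEquiv_zero] using h.2
  have hinj : ∀ x y : Fin n × Fin 2, (p (pairEquiv n x)).1 = (p (pairEquiv n y)).1 → x = y :=
    fun x y h => (pairEquiv n).injective (p.injective (Fin.ext h))
  intro m
  induction m with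
  | zero =>
    intro hm
    obtain ⟨⟨i, b⟩, hv⟩ := ((pairEquiv n).trans p).surjective ⟨0, by omega⟩
    replace hv : (p (pairEquiv n (i, b))).1 = 0 := congrArg Fin.val hv
    refine ⟨i, ?_⟩
    have := hp i
    fin_cases b <;> simp at hv <;> omega
  | succ m ih =>
    intro hm
    obtain ⟨i', hi'⟩ := ih (by omega)
    obtain ⟨⟨i, b⟩, hv⟩ := ((pairEquiv n).trans p).surjective ⟨2*(m+1), by omega⟩
    replace hv : (p (pairEquiv n (i, b))).1 = 2*(m+1) := congrArg Fin.val hv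
    refine ⟨i, ?_⟩
    have hne : i ≠ i' := by
      rintro rfl
      fin_cases b <;> simp at hv <;> omega
    have hne' : ∀ b c, (p (pairEquiv n (i, b))).1 ≠ (p (pairEquiv n (i', c))).1 :=
      fun b c h => hne (congrArg Prod.fst (hinj _ _ h))
    have := hp i
    have h00 := hne' 0 0
    have h01 := hne' 0 1
    have h10 := hne' 1 0
    have h11 := hne' 1 1
    fin_cases b <;> simp at hv <;> omega

/-- The Pfaffian of a tridiagonal skew-symmetric matrix is, up to a positive factor, the product
of every other entry above the diagonal. -/
theorem pfaffSum_tridiagonal {R : Type*} [CommRing R] {n : ℕ}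
    (M : Matrix (Fin (2*n)) (Fin (2*n)) R) (hskew : IsSkew M)
    (htri : ∀ i j, M i j ≠ 0 → i.1 = j.1 + 1 ∨ j.1 = i.1 + 1) :
    ∃ c : ℕ, c ≠ 0 ∧ pfaffSum M =
      c • ∏ i : Fin n, M ⟨2*i.1, by have := i.2; omega⟩ ⟨2*i.1+1, by have := i.2; omega⟩ := by
  classical
  let W := ∏ i : Fin n, M (pairEquiv n (i, 0)) (pairEquiv n (i, 1))
  let T : Equiv.Perm (Fin (2*n)) → R := fun p => (Equiv.Perm.sign p : ℤ) •
    ∏ i : Fin n, M (p (pairEquiv n (i, 0))) (p (pairEquiv n (i, 1)))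
  have hT : ∀ p, T p = 0 ∨ T p = W := by
    intro p
    by_cases hz : ∃ i : Fin n, M (p (pairEquiv n (i, 0))) (p (pairEquiv n (i, 1))) = 0
    · obtain ⟨i, hi⟩ := hz
      left
      simp only [T]
      rw [Finset.prod_eq_zero (Finset.mem_univ i) hi, smul_zero]
    right
    push Not at hz
    choose s f hf using exists_pair_of_adjacent p fun i => htri _ _ (hz i)
    have hs : Function.Injective s := by
      intro j j' h
      have h1 := hf j' 0
      rw [← h, hf j 0] at h1
      exact congrArg Prod.fst ((pairEquiv n).injective h1)
    let τ : Equiv.Perm (Fin n) := Equiv.ofBijective s (Finite.injective_iff_bijective.mp hs)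
    have hp : p * (pairEquiv n).permCongr (Equiv.prodCongrLeft fun _ => τ) =
        (pairEquiv n).permCongr (Equiv.prodCongrRight f) := by
      ext x
      obtain ⟨⟨j, b⟩, rfl⟩ := (pairEquiv n).surjective x
      simpa [τ, Equiv.permCongr_apply] using congrArg Fin.val (hf j b)
    have hsign : Equiv.Perm.sign p = ∏ j, Equiv.Perm.sign (f j) := by
      have := congrArg Equiv.Perm.sign hp
      rw [map_mul, Equiv.Perm.sign_permCongr, Equiv.Perm.sign_permCongr,
        Equiv.Perm.sign_prodCongrLeft, Equiv.Perm.sign_prodCongrRight] at this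
      simpa using this
    have hflip : ∀ (g : Equiv.Perm (Fin 2)) (j : Fin n),
        M (pairEquiv n (j, g 0)) (pairEquiv n (j, g 1)) =
          (Equiv.Perm.sign g : ℤ) • M (pairEquiv n (j, 0)) (pairEquiv n (j, 1)) := by
      intro g j
      have hg : g = 1 ∨ g = Equiv.swap 0 1 := by
        revert g; decide
      rcases hg with rfl | rfl
      · simp
      · simp [hskew (pairEquiv n (j, 0)) (pairEquiv n (j, 1))]
    have hprod : ∏ i : Fin n, M (p (pairEquiv n (i, 0))) (p (pairEquiv n (i, 1))) =
        (Equiv.Perm.sign p : ℤ) • W := by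
      rw [← Equiv.prod_comp τ, hsign]
      have : ∀ j, M (p (pairEquiv n (τ j, 0))) (p (pairEquiv n (τ j, 1))) =
          (Equiv.Perm.sign (f j) : ℤ) • M (pairEquiv n (j, 0)) (pairEquiv n (j, 1)) := by
        intro j
        rw [← hflip]
        exact congrArg₂ M (hf j 0) (hf j 1)
      simp only [this, W, zsmul_eq_mul, Finset.prod_mul_distrib]
      push_cast
      rfl
    simp only [T]
    rw [hprod, smul_smul]
    simp [← Units.val_mul]
  refine ⟨(Finset.univ.filter fun p => T p = W).card, ?_, ?_⟩
  · refine Finset.card_ne_zero_of_mem (a := 1) ?_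
    simp [T, W]
  · have h1 : pfaffSum M = ∑ p, T p := by
      simp only [pfaffSum, T, pairEquiv_zero, pairEquiv_one]
    have h2 : W = ∏ i : Fin n,
        M ⟨2*i.1, by have := i.2; omega⟩ ⟨2*i.1+1, by have := i.2; omega⟩ := by
      simp only [W, pairEquiv_zero, pairEquiv_one]
    rw [h1, ← h2, ← Finset.sum_const, Finset.sum_filter]
    refine Finset.sum_congr rfl fun p _ => ?_
    split_ifs with h
    · exact h
    · exact (hT p).resolve_right h

/-- The order embedding of `Fin (2*(k-1))` in `Fin (2*k)` that skips `2*a` and `2*b+1`. -/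
def skipPair {k : ℕ} (a b : ℕ) : Fin (2*(k-1)) ↪o Fin (2*k) :=
  OrderEmbedding.ofStrictMono
    (fun v => if v.1 < 2*a then ⟨v.1, by have := v.2; omega⟩
      else if v.1 < 2*b then ⟨v.1+1, by have := v.2; omega⟩ else ⟨v.1+2, by have := v.2; omega⟩)
    (by
      intro v w h
      rw [Fin.lt_def] at h
      dsimp only
      split_ifs <;> simp only [Fin.lt_def] <;> omega)

theorem skipPair_val {k : ℕ} (a b : ℕ) (v : Fin (2*(k-1))) :
    (skipPair a b v : Fin (2*k)).1 =
      if v.1 < 2*a then v.1 else if v.1 < 2*b then v.1+1 else v.1+2 := by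
  change (if v.1 < 2*a then _ else if v.1 < 2*b then _ else _ : Fin (2*k)).1 = _
  split_ifs <;> rfl

/-- The weights of the edges of a path: the even edges carry `X 0` up to position `2*u` and `X 3`
after it, the odd ones carry `X 1` and then `X 2`. -/
noncomputable def pathWeight (u q : ℕ) : MvPolynomial (Fin 4) ℂ :=
  if q % 2 = 0 then (if q < 2*u then X 0 else X 3) else (if q < 2*u then X 1 else X 2)

/-- The skew-symmetric tridiagonal matrix with entries `pathWeight u` above the diagonal. -/
noncomputable def pathMatrix (m u : ℕ) : Matrix (Fin m) (Fin m) (MvPolynomial (Fin 4) ℂ) :=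
  fun i j => if j.1 = i.1 + 1 then pathWeight u i.1
    else if i.1 = j.1 + 1 then -pathWeight u j.1 else 0

theorem isSkew_pathMatrix (m u : ℕ) : IsSkew (pathMatrix m u) := by
  intro i j
  simp only [pathMatrix]
  split_ifs <;> first | omega | simp

theorem isHomogeneous_pathMatrix (m u : ℕ) (i j : Fin m) :
    (pathMatrix m u i j).IsHomogeneous 1 := by
  have h : ∀ q, (pathWeight u q).IsHomogeneous 1 := by
    intro q
    simp only [pathWeight]
    split_ifs <;> exact isHomogeneous_X _ _
  simp only [pathMatrix]
  split_ifs
  · exact h _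
  · exact (h _).neg
  · exact isHomogeneous_zero _ _ _

theorem pathMatrix_ne_zero {m u : ℕ} {i j : Fin m} (h : pathMatrix m u i j ≠ 0) :
    i.1 = j.1 + 1 ∨ j.1 = i.1 + 1 := by
  by_contra hc
  push Not at hc
  exact h (by simp [pathMatrix, hc.1, hc.2])

theorem prod_range_ite_four {R : Type*} [CommMonoid R] (a b c d : ℕ) (x y z w : R) :
    ∏ i ∈ Finset.range (a + b + c + d),
      (if i < a then x else if i < a+b then y else if i < a+b+c then z else w) =
      x ^ a * y ^ b * z ^ c * w ^ d := by
  have h : ∀ (m : ℕ) (f : ℕ → R) (r : R), (∀ i < m, f i = r) →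
      ∏ i ∈ Finset.range m, f i = r ^ m := fun m f r hf => by
    rw [Finset.prod_congr rfl fun i hi => hf i (Finset.mem_range.mp hi), Finset.prod_const,
      Finset.card_range]
  rw [Finset.prod_range_add, Finset.prod_range_add, Finset.prod_range_add, h a _ x, h b _ y,
    h c _ z, h d _ w]
  all_goals
    intro i hi
    split_ifs <;> first | rfl | omega

theorem pathMatrix_skipPair_apply {k a b c : ℕ} (i : Fin (k-1)) :
    (pathMatrix (2*k) (a+b)).submatrix (skipPair a (a+b+c)) (skipPair a (a+b+c))
        ⟨2*i.1, by have := i.2; omega⟩ ⟨2*i.1+1, by have := i.2; omega⟩ =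
      if i.1 < a then X 0 else if i.1 < a+b then X 1 else if i.1 < a+b+c then X 2 else X 3 := by
  have hsucc : (skipPair a (a+b+c) ⟨2*i.1+1, by have := i.2; omega⟩ : Fin (2*k)).1 =
      (skipPair a (a+b+c) ⟨2*i.1, by have := i.2; omega⟩ : Fin (2*k)).1 + 1 := by
    simp only [skipPair_val]
    split_ifs <;> omega
  rw [Matrix.submatrix_apply, pathMatrix, if_pos hsucc, skipPair_val]
  simp only [pathWeight]
  split_ifs <;> first | rfl | omega

theorem prod_pathMatrix_skipPair {k a b c d : ℕ} (h : a + b + c + d = k - 1) :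
    ∏ i : Fin (k-1), (pathMatrix (2*k) (a+b)).submatrix
        (skipPair a (a+b+c)) (skipPair a (a+b+c))
        ⟨2*i.1, by have := i.2; omega⟩ ⟨2*i.1+1, by have := i.2; omega⟩ =
      X 0 ^ a * X 1 ^ b * X 2 ^ c * X 3 ^ d := by
  simp only [pathMatrix_skipPair_apply]
  rw [Fin.prod_univ_eq_prod_range fun i => if i < a then (X 0 : MvPolynomial (Fin 4) ℂ) else
    if i < a+b then X 1 else if i < a+b+c then X 2 else X 3, ← h, prod_range_ite_four]

theorem pfaffSum_pathMatrix_skipPair {k a b c d : ℕ} (h : a + b + c + d = k - 1) :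
    ∃ z : ℕ, z ≠ 0 ∧ pfaffSum ((pathMatrix (2*k) (a+b)).submatrix
        (skipPair a (a+b+c) : Fin (2*(k-1)) ↪o Fin (2*k)) (skipPair a (a+b+c))) =
      z • (X 0 ^ a * X 1 ^ b * X 2 ^ c * X 3 ^ d) := by
  rw [← prod_pathMatrix_skipPair h]
  refine pfaffSum_tridiagonal _ (fun i j => isSkew_pathMatrix _ _ _ _) fun i j hij => ?_
  have := pathMatrix_ne_zero hij
  simp only [skipPair_val] at this
  split_ifs at this <;> omega

/-- The matrix of linear forms whose coefficients are those prescribed by `φ`. -/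
noncomputable def linearMatrix {τ m σ R : Type*} [Fintype σ] [CommRing R]
    (φ : τ × m × m × (σ →₀ ℕ) → R) (i : τ) : Matrix m m (MvPolynomial σ R) :=
  fun r c => ∑ v : σ, C (φ (i, r, c, Finsupp.single v 1)) * X v

theorem linearMatrix_map {τ m σ R S : Type*} [Fintype σ] [CommRing R] [CommRing S] (f : R →+* S)
    (φ : τ × m × m × (σ →₀ ℕ) → R) (i : τ) :
    (linearMatrix φ i).map (MvPolynomial.map f) = linearMatrix (f ∘ φ) i := by
  ext1 r c
  simp [linearMatrix]

theorem linearMatrix_coeff {τ m σ R : Type*} [Fintype σ] [CommRing R]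
    (H : τ → Matrix m m (MvPolynomial σ R)) (hH : ∀ i r c, (H i r c).IsHomogeneous 1) (i : τ) :
    linearMatrix (fun x => coeff x.2.2.2 (H x.1 x.2.1 x.2.2.1)) i = H i := by
  classical
  ext1 r c
  ext s
  simp only [linearMatrix, coeff_sum, coeff_C_mul, coeff_X]
  by_cases hs : s.degree = 1
  · obtain ⟨v, rfl⟩ := (Finsupp.sum_eq_one_iff s).mp hs
    simp [Finsupp.single_left_inj]
  · rw [(hH i r c).coeff_eq_zero hs]
    refine Finset.sum_eq_zero fun v _ => ?_
    rw [if_neg, mul_zero]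
    rintro rfl
    simp at hs

theorem isHomogeneous_mem_of_det_coeff_ne_zero {σ K ι : Type*} [Field K] [Fintype ι]
    [DecidableEq ι] {n : ℕ} (m : ι ↪ (σ →₀ ℕ)) (hm : ∀ s, s ∈ Set.range m ↔ s.degree = n)
    (q : ι → MvPolynomial σ K) (hq : ∀ i, (q i).IsHomogeneous n)
    (hdet : (Matrix.of fun i j => coeff (m j) (q i)).det ≠ 0)
    {I : Ideal (MvPolynomial σ K)} (hI : ∀ i, q i ∈ I) {d : ℕ} (hd : n ≤ d)
    {F : MvPolynomial σ K} (hF : F.IsHomogeneous d) : F ∈ I := by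
  set D : Matrix ι ι K := Matrix.of fun i j => coeff (m j) (q i) with hD
  have hqi : ∀ i, q i = ∑ j, C (D i j) * monomial (m j) 1 := by
    classical
    intro i
    ext s
    simp only [coeff_sum, coeff_C_mul, coeff_monomial]
    by_cases hs : s.degree = n
    · obtain ⟨j, rfl⟩ := (hm s).mpr hs
      simp [m.injective.eq_iff, hD]
    · rw [(hq i).coeff_eq_zero hs]
      symm
      refine Finset.sum_eq_zero fun j _ => ?_
      rw [if_neg, mul_zero]
      rintro rfl
      exact hs ((hm _).mp ⟨j, rfl⟩)
  have hmon : ∀ t, monomial (m t) (1 : K) ∈ I := by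
    intro t
    have : monomial (m t) (1 : K) = ∑ i, C (D⁻¹ t i) * q i := by
      simp only [hqi, Finset.mul_sum]
      rw [Finset.sum_comm]
      have hsum : ∀ j, ∑ i, C (D⁻¹ t i) * (C (D i j) * monomial (m j) (1 : K)) =
          C ((1 : Matrix ι ι K) t j) * monomial (m j) 1 := by
        intro j
        rw [← Matrix.nonsing_inv_mul D (isUnit_iff_ne_zero.mpr hdet), Matrix.mul_apply, map_sum,
          Finset.sum_mul]
        simp [mul_assoc]
      simp [hsum, Matrix.one_apply, apply_ite]
    rw [this]
    exact Ideal.sum_mem _ fun i _ => Ideal.mul_mem_left _ _ (hI i)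
  rw [F.as_sum]
  refine Ideal.sum_mem _ fun s hs => ?_
  have hsd : s.degree = d := by
    by_contra h
    exact mem_support_iff.mp hs (hF.coeff_eq_zero h)
  obtain ⟨r, hr, hrn⟩ := Finsupp.exists_le_degree_eq s n (hsd ▸ hd)
  obtain ⟨t, rfl⟩ := (hm r).mpr hrn
  have : monomial s (coeff s F) = monomial (s - m t) (coeff s F) * monomial (m t) 1 := by
    rw [monomial_mul, tsub_add_cancel_of_le hr, mul_one]
  rw [this]
  exact Ideal.mul_mem_left _ _ (hmon t)

/-- For a general choice of `k` skew-symmetric `2k × 2k` matrices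
`H 0, …, H (k-1)` of linear forms in four variables, the ideal generated by the
submaximal Pfaffians of all the `H i` contains every form of degree `d ≥ k`.
Genericity is expressed by a nonzero polynomial `P` in the coefficients of the tuple of
matrices, cutting out a nonempty Zariski-open subset of the parameter space. -/
theorem submax_pfaffians_of_k_general_linear_matrices_fill_top_degrees
    (k : ℕ) (hk : 0 < k) :
    ∃ P : MvPolynomial (Fin k × Fin (2*k) × Fin (2*k) × ((Fin 4) →₀ ℕ)) ℂ, P ≠ 0 ∧
      (∃ H : Fin k → Matrix (Fin (2*k)) (Fin (2*k)) (MvPolynomial (Fin 4) ℂ),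
        (∀ i, IsSkew (H i)) ∧ (∀ i r c, ((H i) r c).IsHomogeneous 1) ∧
        MvPolynomial.eval
          (fun x => MvPolynomial.coeff x.2.2.2 (H x.1 x.2.1 x.2.2.1)) P ≠ 0) ∧
      ∀ H : Fin k → Matrix (Fin (2*k)) (Fin (2*k)) (MvPolynomial (Fin 4) ℂ),
        (∀ i, IsSkew (H i)) → (∀ i r c, ((H i) r c).IsHomogeneous 1) →
        MvPolynomial.eval
          (fun x => MvPolynomial.coeff x.2.2.2 (H x.1 x.2.1 x.2.2.1)) P ≠ 0 →
        ∀ d : ℕ, k ≤ d →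
          ∀ F : MvPolynomial (Fin 4) ℂ, F.IsHomogeneous d →
            F ∈ Ideal.span (⋃ i, submaxPfEven (H i)) := by
  classical
  let S := (Finset.univ : Finset (Fin 4)).finsuppAntidiag (k-1)
  have hS : ∀ s : Fin 4 →₀ ℕ, s ∈ S ↔ s.degree = k - 1 := by
    intro s
    simp [S, Finset.mem_finsuppAntidiag, Finsupp.degree_eq_sum]
  have hsum : ∀ s : S, s.1 0 + s.1 1 + s.1 2 + s.1 3 = k - 1 := by
    intro s
    rw [← (hS s.1).mp s.2, Finsupp.degree_eq_sum, Fin.sum_univ_four]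
  let idx : S → Fin k := fun s => ⟨s.1 0 + s.1 1, by have := hsum s; omega⟩
  let emb : S → (Fin (2*(k-1)) ↪o Fin (2*k)) := fun s =>
    skipPair (s.1 0) (s.1 0 + s.1 1 + s.1 2)
  let U := linearMatrix (X : Fin k × Fin (2*k) × Fin (2*k) × ((Fin 4) →₀ ℕ) →
    MvPolynomial (Fin k × Fin (2*k) × Fin (2*k) × ((Fin 4) →₀ ℕ)) ℂ)
  let P := (Matrix.of fun s t : S =>
    coeff t.1 (pfaffSum ((U (idx s)).submatrix (emb s) (emb s)))).det
  have hP : ∀ H : Fin k → Matrix (Fin (2*k)) (Fin (2*k)) (MvPolynomial (Fin 4) ℂ),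
      (∀ i r c, ((H i) r c).IsHomogeneous 1) →
      eval (fun x => coeff x.2.2.2 (H x.1 x.2.1 x.2.2.1)) P = (Matrix.of fun s t : S =>
        coeff t.1 (pfaffSum ((H (idx s)).submatrix (emb s) (emb s)))).det := by
    intro H hH
    simp only [P]
    rw [RingHom.map_det]
    congr 1
    ext s t
    simp only [RingHom.mapMatrix_apply, Matrix.map_apply, Matrix.of_apply]
    rw [← coeff_map, map_pfaffSum, ← Matrix.submatrix_map, linearMatrix_map]
    have : (eval fun x => coeff x.2.2.2 (H x.1 x.2.1 x.2.2.1)) ∘ X =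
        fun x : Fin k × Fin (2*k) × Fin (2*k) × ((Fin 4) →₀ ℕ) =>
          coeff x.2.2.2 (H x.1 x.2.1 x.2.2.1) := by
      ext x; simp
    rw [this, linearMatrix_coeff H hH]
  have hex : eval (fun x => coeff x.2.2.2 (pathMatrix (2*k) x.1.1 x.2.1 x.2.2.1)) P ≠ 0 := by
    rw [hP (fun i => pathMatrix (2*k) i.1) fun i r c => isHomogeneous_pathMatrix _ _ _ _]
    choose z hz hpf using fun s : S => pfaffSum_pathMatrix_skipPair (hsum s)
    have hdiag : (Matrix.of fun s t : S => coeff t.1 (pfaffSum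
        ((pathMatrix (2*k) (idx s).1).submatrix (emb s) (emb s)))) =
        Matrix.diagonal fun s => (z s : ℂ) := by
      ext s t
      have hmon : (X 0 ^ s.1 0 * X 1 ^ s.1 1 * X 2 ^ s.1 2 * X 3 ^ s.1 3 :
          MvPolynomial (Fin 4) ℂ) = monomial s.1 1 := by
        rw [monomial_eq, Finsupp.prod_fintype _ _ (by simp), Fin.prod_univ_four]
        simp
      rw [Matrix.of_apply]
      simp only [idx, emb]
      rw [hpf s, hmon, coeff_smul, coeff_monomial, Matrix.diagonal_apply]
      by_cases hst : s = t
      · simp [hst]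
      · rw [if_neg hst, if_neg fun h => hst (Subtype.ext h), smul_zero]
    rw [hdiag, Matrix.det_diagonal]
    exact Finset.prod_ne_zero_iff.mpr fun s _ => Nat.cast_ne_zero.mpr (hz s)
  refine ⟨P, fun h => hex (by rw [h, map_zero]), ⟨fun i => pathMatrix (2*k) i.1,
    fun i => isSkew_pathMatrix _ _, fun i r c => isHomogeneous_pathMatrix _ _ _ _, hex⟩, ?_⟩
  intro H _ hH hne d hd F hF
  rw [hP H hH] at hne
  refine isHomogeneous_mem_of_det_coeff_ne_zero (n := k - 1) (Function.Embedding.subtype _)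
    (fun s => by simp [hS])
    (fun s => pfaffSum ((H (idx s)).submatrix (emb s) (emb s)))
    (fun s => isHomogeneous_pfaffSum fun i j => hH _ _ _) hne (fun s => ?_) (by omega) hF
  rw [pfaffSum_eq_smul_pfaff]
  exact Submodule.smul_of_tower_mem _ _
    (Ideal.subset_span (Set.mem_iUnion.mpr ⟨idx s, emb s, rfl⟩))
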